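/- Suppose m ≥ 2 and k ≤ n (f_1 − ε). Then V_off^*(n,k) − V_na^*(n,k) ≤ a_2/(4ε). -/

import Mathlib

open MeasureTheory ProbabilityTheory Finset

noncomputable section

namespace MultiSecretary

variable {Ω : Type*}

/-- `Z_j^r`: the number of candidates with ability `aj` among the first `r`
(candidates are indexed `0, 1, …`, so `X 0, …, X (r-1)` are the first `r`). -/
def Zc (X : ℕ → Ω → ℝ) (aj : ℝ) (r : ℕ) (ω : Ω) : ℝ :=
  ∑ t ∈ range r, if X t ω = aj then 1 else 0

/-- `F̄(a_j) = f_1 + ⋯ + f_{j-1}`. -/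
def Fbar (f : ℕ → ℝ) (j : ℕ) : ℝ := ∑ i ∈ Icc 1 (j - 1), f i

/-- The offline-sort count `𝔖_j^r = min { Z_j^r , (k - ∑_{i<j} Z_i^r)_+ }`. -/
def Soff (a : ℕ → ℝ) (X : ℕ → Ω → ℝ) (k r j : ℕ) (ω : Ω) : ℝ :=
  min (Zc X (a j) r ω) (max ((k : ℝ) - ∑ i ∈ Icc 1 (j - 1), Zc X (a i) r ω) 0)

/-- The offline value `V_off^*(n,k) = ∑_j a_j E[𝔖_j^n]`. -/
def Voff [MeasurableSpace Ω] (μ : Measure Ω) (m : ℕ) (a : ℕ → ℝ) (X : ℕ → Ω → ℝ)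
    (n k : ℕ) : ℝ :=
  ∑ j ∈ Icc 1 m, a j * ∫ ω, Soff a X k n j ω ∂μ

/-- The σ-field `𝓕_t` generated by the first `t` pairs `(X_s, U_s)`. -/
def Fil (X U : ℕ → Ω → ℝ) (t : ℕ) : MeasurableSpace Ω :=
  MeasurableSpace.comap (fun ω => fun s : Fin t => (X s ω, U s ω)) inferInstance

/-- A feasible online policy for the `(n,k)` multi-secretary problem: `σp t` is the
(0/1-valued) decision about candidate `t` (0-indexed), measurable with respect to
`𝓕_{t+1} = σ(X_0,U_0,…,X_t,U_t)`, and at most `k` candidates are selected. -/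
def IsPolicy (X U : ℕ → Ω → ℝ) (n k : ℕ) (σp : ℕ → Ω → ℕ) : Prop :=
  (∀ t ω, σp t ω ≤ 1) ∧
  (∀ t, Measurable[Fil X U (t + 1)] (σp t)) ∧
  (∀ ω, ∑ t ∈ range n, σp t ω ≤ k)

/-- The value `V_on^π(n,k)` of an online policy. -/
def Von [MeasurableSpace Ω] (μ : Measure Ω) (X : ℕ → Ω → ℝ) (n : ℕ) (σp : ℕ → Ω → ℕ) : ℝ :=
  ∫ ω, (∑ t ∈ range n, X t ω * (σp t ω : ℝ)) ∂μ

/-- `V_on^*(n,k)`, the optimal value over feasible online policies. -/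
def VonStar [MeasurableSpace Ω] (μ : Measure Ω) (X U : ℕ → Ω → ℝ) (n k : ℕ) : ℝ :=
  sSup {v : ℝ | ∃ σp, IsPolicy X U n k σp ∧ v = Von μ X n σp}

/-- `S_j^{π,r}`: the number of `a_j`-candidates selected by policy `π` among the first `r`. -/
def Spol (a : ℕ → ℝ) (X : ℕ → Ω → ℝ) (σp : ℕ → Ω → ℕ) (j r : ℕ) (ω : Ω) : ℝ :=
  ∑ t ∈ range r, (σp t ω : ℝ) * (if X t ω = a j then 1 else 0)

/-- The Budget-Ratio thresholds: `T_1 = 0`, `T_j = (F̄(a_j)+F̄(a_{j+1}))/2` for `j ≥ 2`. -/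
def Tthr (f : ℕ → ℝ) (j : ℕ) : ℝ := if j = 1 then 0 else (Fbar f j + Fbar f (j + 1)) / 2

/-- The index `j ∈ [m]` with `T_j ≤ x < T_{j+1}` (with `T_{m+1} = ∞`), i.e. the largest
`j ∈ [m]` with `T_j ≤ x`. -/
def jBR (m : ℕ) (f : ℕ → ℝ) (x : ℝ) : ℕ :=
  ((Icc 1 m).filter fun j => Tthr f j ≤ x).sup id

/-- The remaining-budget process `K_t` of the Budget-Ratio policy: `K_0 = k`, and the
candidate `X_t` (presented at time `t+1`, 1-indexed) is selected iff `K_t > 0` and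
`X_t > a_{j+1}` where `T_j ≤ K_t/(n-t) < T_{j+1}` (for `j = m`, i.e. `T_m ≤ K_t/(n-t)`,
every candidate is selected since `T_{m+1} = ∞` and `a_{m+1} < a_m`). -/
def Kbr (m : ℕ) (a f : ℕ → ℝ) (X : ℕ → Ω → ℝ) (n k : ℕ) : ℕ → Ω → ℕ
  | 0, _ => k
  | t + 1, ω =>
    Kbr m a f X n k t ω -
      (if 0 < Kbr m a f X n k t ω ∧
          (jBR m f ((Kbr m a f X n k t ω : ℝ) / ((n : ℝ) - t)) = m ∨
            a (jBR m f ((Kbr m a f X n k t ω : ℝ) / ((n : ℝ) - t)) + 1) < X t ω)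
        then 1 else 0)

/-- The selection decisions `σ^br` of the Budget-Ratio policy (0-indexed candidates). -/
def σbr (m : ℕ) (a f : ℕ → ℝ) (X : ℕ → Ω → ℝ) (n k : ℕ) (t : ℕ) (ω : Ω) : ℕ :=
  Kbr m a f X n k t ω - Kbr m a f X n k (t + 1) ω

/-- The Bernoulli selection indicators `B_t` of a non-adaptive policy `p = (p_{j,t})`. -/
def Bna (m : ℕ) (a : ℕ → ℝ) (p : ℕ → ℕ → ℝ) (X U : ℕ → Ω → ℝ) (t : ℕ) (ω : Ω) : ℝ :=
  ∑ j ∈ Icc 1 m, if U t ω ≤ p j t ∧ X t ω = a j then 1 else 0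

/-- The stopping time `ν = min{ r ≥ 1 : B_1 + ⋯ + B_r ≥ k or r ≥ n }` of a
non-adaptive policy. -/
def nuNA (m : ℕ) (a : ℕ → ℝ) (p : ℕ → ℕ → ℝ) (X U : ℕ → Ω → ℝ) (n k : ℕ) (ω : Ω) : ℕ :=
  sInf {r : ℕ | 1 ≤ r ∧ ((k : ℝ) ≤ ∑ t ∈ range r, Bna m a p X U t ω ∨ n ≤ r)}

/-- The value `V_on^π(n,k) = ∑_j a_j E[∑_{t ≤ ν} B_t 1(X_t = a_j)]` of a non-adaptive policy. -/
def VonNA [MeasurableSpace Ω] (μ : Measure Ω) (m : ℕ) (a : ℕ → ℝ) (p : ℕ → ℕ → ℝ)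
    (X U : ℕ → Ω → ℝ) (n k : ℕ) : ℝ :=
  ∑ j ∈ Icc 1 m, a j *
    ∫ ω, (∑ t ∈ range (nuNA m a p X U n k ω), if X t ω = a j then Bna m a p X U t ω else 0) ∂μ

/-- `V_na^*(n,k)`: the optimal value over non-adaptive policies. -/
def VnaStar [MeasurableSpace Ω] (μ : Measure Ω) (m : ℕ) (a : ℕ → ℝ) (X U : ℕ → Ω → ℝ)
    (n k : ℕ) : ℝ :=
  sSup {v : ℝ | ∃ p : ℕ → ℕ → ℝ,
    (∀ j t, 0 ≤ p j t ∧ p j t ≤ 1) ∧ v = VonNA μ m a p X U n k}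

/-- The deterministic relaxation `DR(n,k)`. -/
def DRval (m : ℕ) (a f : ℕ → ℝ) (n k : ℕ) : ℝ :=
  sSup {v : ℝ | ∃ s : ℕ → ℝ,
    (∀ j ∈ Icc 1 m, 0 ≤ s j ∧ s j ≤ (n : ℝ) * f j) ∧
    (∑ j ∈ Icc 1 m, s j) ≤ (k : ℝ) ∧ v = ∑ j ∈ Icc 1 m, a j * s j}

/-- The optimal solution `s_j^* = min{ n f_j, (k - n F̄(a_j))_+ }` of the deterministic
relaxation. -/
def sStar (f : ℕ → ℝ) (n k j : ℕ) : ℝ :=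
  min ((n : ℝ) * f j) (max ((k : ℝ) - (n : ℝ) * Fbar f j) 0)

/-- `J0Spec m f n k j` says that `j = j₀(n,k)`, the action index of `(n,k)`. -/
def J0Spec (m : ℕ) (f : ℕ → ℝ) (n k j : ℕ) : Prop :=
  (j = 1 ∧ (k : ℝ) / (n : ℝ) < f 1 + f 2 / 2) ∨
  (1 ≤ j ∧ j + 1 ≤ m ∧ Fbar f j + f j / 2 ≤ (k : ℝ) / (n : ℝ) ∧
    (k : ℝ) / (n : ℝ) < Fbar f (j + 2) - f (j + 1) / 2) ∨
  (j = m ∧ 1 - f m / 2 ≤ (k : ℝ) / (n : ℝ))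

/-- The budget ratio `K_t / (n - t)`. -/
def ratio (K : ℕ → Ω → ℕ) (n t : ℕ) (ω : Ω) : ℝ := (K t ω : ℝ) / ((n : ℝ) - t)

/-- The time `τ₀` at which the budget ratio first enters the `δ/2`-orbit of a threshold
(or the deterministic time `n - 2δ⁻¹ - 1` is reached). -/
def tau0 (m : ℕ) (f : ℕ → ℝ) (δ : ℝ) (K : ℕ → Ω → ℕ) (n : ℕ) (ω : Ω) : ℕ :=
  sInf {t : ℕ |
    (∃ j ∈ Icc 1 m, |ratio K n t ω - Tthr f j| ≤ δ / 2) ∨ (n : ℝ) - 2 / δ - 1 ≤ (t : ℝ)}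

/-- The index `j(τ₀)` of the threshold entered at time `τ₀` (set to `m+1`, corresponding to
`T_{j(τ₀)} = ∞`, when `τ₀ ≥ n - 2δ⁻¹ - 1`). -/
def jTau0 (m : ℕ) (f : ℕ → ℝ) (δ : ℝ) (K : ℕ → Ω → ℕ) (n : ℕ) (ω : Ω) : ℕ :=
  if (tau0 m f δ K n ω : ℝ) < (n : ℝ) - 2 / δ - 1 then
    sInf {j : ℕ | j ∈ Icc 1 m ∧ |ratio K n (tau0 m f δ K n ω) ω - Tthr f j| ≤ δ / 2}
  else m + 1

/-- The exit time `τ = inf{ t > τ₀ : |K_t/(n-t) - T_{j(τ₀)}| > δ or t ≥ n - 2δ⁻¹ - 1 }`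
(for `j(τ₀) = m + 1`, i.e. `T_{j(τ₀)} = ∞`, the first condition is vacuous). -/
def tauBR (m : ℕ) (f : ℕ → ℝ) (δ : ℝ) (K : ℕ → Ω → ℕ) (n : ℕ) (ω : Ω) : ℕ :=
  sInf {t : ℕ | tau0 m f δ K n ω < t ∧
    ((n : ℝ) - 2 / δ - 1 ≤ (t : ℝ) ∨
      (jTau0 m f δ K n ω ≤ m ∧ δ < |ratio K n t ω - Tthr f (jTau0 m f δ K n ω)|))}

/-- The deviation process `Y_u = K_{τ₀+u} - T_{j(τ₀)} (n - τ₀ - u)`. -/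
def Ydev (m : ℕ) (f : ℕ → ℝ) (δ : ℝ) (K : ℕ → Ω → ℕ) (n : ℕ) (u : ℕ) (ω : Ω) : ℝ :=
  (K (tau0 m f δ K n ω + u) ω : ℝ) -
    Tthr f (jTau0 m f δ K n ω) * ((n : ℝ) - (tau0 m f δ K n ω : ℝ) - (u : ℝ))

/-- The minimal mass `min{f_1, …, f_m}` of the ability distribution. -/
def minf (m : ℕ) (f : ℕ → ℝ) : ℝ := sInf {x : ℝ | ∃ j, 1 ≤ j ∧ j ≤ m ∧ x = f j}

/-- The standing model hypotheses of the multi-secretary problem: the abilities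
`0 < a_m < ⋯ < a_1`, the probability mass function `f`, and the i.i.d. sequence of
abilities `X_t` together with the auxiliary i.i.d. uniform randomization variables `U_t`. -/
structure Model [MeasurableSpace Ω] (μ : Measure Ω) (m : ℕ) (a f : ℕ → ℝ)
    (X U : ℕ → Ω → ℝ) : Prop where
  hm : 1 ≤ m
  ha_anti : ∀ j, 1 ≤ j → j < m → a (j + 1) < a j
  ha_pos : 0 < a m
  hf_pos : ∀ j, 1 ≤ j → j ≤ m → 0 < f j
  hf_sum : ∑ j ∈ Icc 1 m, f j = 1
  hprob : IsProbabilityMeasure μ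
  hXmeas : ∀ t, Measurable (X t)
  hUmeas : ∀ t, Measurable (U t)
  hXdist : ∀ t j, 1 ≤ j → j ≤ m → μ {ω | X t ω = a j} = ENNReal.ofReal (f j)
  hUdist : ∀ t, μ.map (U t) = volume.restrict (Set.Icc (0 : ℝ) 1)
  hIndep : iIndepFun (fun t ω => (X t ω, U t ω)) μ
  hXUIndep : ∀ t, IndepFun (X t) (U t) μ

/-- The standing model hypotheses with only the ability sequence `X` (no auxiliary
randomization). -/
structure ModelX [MeasurableSpace Ω] (μ : Measure Ω) (m : ℕ) (a f : ℕ → ℝ)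
    (X : ℕ → Ω → ℝ) : Prop where
  hm : 1 ≤ m
  ha_anti : ∀ j, 1 ≤ j → j < m → a (j + 1) < a j
  ha_pos : 0 < a m
  hf_pos : ∀ j, 1 ≤ j → j ≤ m → 0 < f j
  hf_sum : ∑ j ∈ Icc 1 m, f j = 1
  hprob : IsProbabilityMeasure μ
  hXmeas : ∀ t, Measurable (X t)
  hXdist : ∀ t j, 1 ≤ j → j ≤ m → μ {ω | X t ω = a j} = ENNReal.ofReal (f j)
  hIndep : iIndepFun X μ


lemma aux_a_anti {m : ℕ} {a : ℕ → ℝ} (h : ∀ j, 1 ≤ j → j < m → a (j + 1) < a j)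
    {i : ℕ} (hi : 1 ≤ i) (j : ℕ) (hij : i ≤ j) : j ≤ m → a j ≤ a i := by
  induction j, hij using Nat.le_induction with
  | base => intro _; exact le_rfl
  | succ j hj ih =>
    intro hjm
    exact (h j (by omega) (by omega)).le.trans (ih (by omega))

lemma aux_minf_pos {m : ℕ} {f : ℕ → ℝ} (hm : 1 ≤ m)
    (hf : ∀ j, 1 ≤ j → j ≤ m → 0 < f j) : 0 < minf m f := by
  have hfin : {x : ℝ | ∃ j, 1 ≤ j ∧ j ≤ m ∧ x = f j}.Finite := by
    refine ((Finset.Icc 1 m).finite_toSet.image f).subset ?_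
    rintro x ⟨j, h1, h2, rfl⟩
    exact ⟨j, by simp [h1, h2], rfl⟩
  have hne : {x : ℝ | ∃ j, 1 ≤ j ∧ j ≤ m ∧ x = f j}.Nonempty := ⟨f 1, 1, le_rfl, hm, rfl⟩
  obtain ⟨j, h1, h2, h3⟩ := hne.csInf_mem hfin
  unfold minf
  rw [h3]
  exact hf j h1 h2

lemma aux_sort_sum (z : ℕ → ℝ) (hz : ∀ i, 0 ≤ z i) (k : ℝ) (hk : 0 ≤ k) (M : ℕ) :
    ∑ j ∈ Icc 1 M, min (z j) (max (k - ∑ i ∈ Icc 1 (j - 1), z i) 0)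
      = min k (∑ i ∈ Icc 1 M, z i) := by
  induction M with
  | zero => simp [hk]
  | succ M ih =>
    rw [Finset.sum_Icc_succ_top (by omega), Finset.sum_Icc_succ_top (by omega), ih]
    simp only [Nat.add_sub_cancel]
    have := hz (M + 1)
    generalize ∑ i ∈ Icc 1 M, z i = s
    rcases le_total k s with h1 | h1 <;> rcases le_total k (s + z (M+1)) with h2 | h2 <;>
      simp only [min_def, max_def] <;> split_ifs <;> linarith

lemma Zc_nonneg {Ω : Type*} (X : ℕ → Ω → ℝ) (c : ℝ) (r : ℕ) (ω : Ω) : 0 ≤ Zc X c r ω :=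
  Finset.sum_nonneg fun t _ => by split_ifs <;> norm_num

lemma Zc_mono {Ω : Type*} (X : ℕ → Ω → ℝ) (c : ℝ) (ω : Ω) {r s : ℕ} (h : r ≤ s) :
    Zc X c r ω ≤ Zc X c s ω :=
  Finset.sum_le_sum_of_subset_of_nonneg (by simpa using h)
    fun t _ _ => by split_ifs <;> norm_num

lemma Zc_le {Ω : Type*} (X : ℕ → Ω → ℝ) (c : ℝ) (r : ℕ) (ω : Ω) : Zc X c r ω ≤ r := by
  have : Zc X c r ω ≤ ∑ t ∈ range r, (1 : ℝ) :=
    Finset.sum_le_sum fun t _ => by split_ifs <;> norm_num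
  simpa using this

lemma Zc_nat {Ω : Type*} (X : ℕ → Ω → ℝ) (c : ℝ) (r : ℕ) (ω : Ω) :
    ∃ N : ℕ, Zc X c r ω = N :=
  ⟨((range r).filter fun t => X t ω = c).card, by simp [Zc]⟩

lemma Zc_meas {Ω : Type*} [MeasurableSpace Ω] (X : ℕ → Ω → ℝ) (hX : ∀ t, Measurable (X t))
    (c : ℝ) (r : ℕ) : Measurable (Zc X c r) := by
  unfold Zc
  refine Finset.measurable_sum _ fun t _ => ?_
  exact Measurable.ite ((hX t) (measurableSet_singleton c)) measurable_const measurable_const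

lemma Soff_meas {Ω : Type*} [MeasurableSpace Ω] (a : ℕ → ℝ) (X : ℕ → Ω → ℝ)
    (hX : ∀ t, Measurable (X t)) (k n j : ℕ) : Measurable (Soff a X k n j) := by
  unfold Soff
  exact (Zc_meas X hX _ n).min ((measurable_const.sub
    (Finset.measurable_sum _ fun i _ => Zc_meas X hX _ n)).max measurable_const)

lemma Soff_nonneg {Ω : Type*} (a : ℕ → ℝ) (X : ℕ → Ω → ℝ) (k n j : ℕ) (ω : Ω) :
    0 ≤ Soff a X k n j ω := le_min (Zc_nonneg _ _ _ _) (le_max_right _ _)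

lemma Soff_int {Ω : Type*} [MeasurableSpace Ω] (μ : Measure Ω) [IsProbabilityMeasure μ]
    (a : ℕ → ℝ) (X : ℕ → Ω → ℝ)
    (hX : ∀ t, Measurable (X t)) (k n j : ℕ) : Integrable (Soff a X k n j) μ := by
  refine Integrable.of_bound (Soff_meas a X hX k n j).aestronglyMeasurable (n : ℝ) ?_
  refine Filter.Eventually.of_forall fun ω => ?_
  rw [Real.norm_of_nonneg (Soff_nonneg ..)]
  exact (min_le_left _ _).trans (Zc_le ..)

/-- The expected shortfall bound. -/
lemma shortfall {Ω : Type*} [MeasurableSpace Ω] (μ : Measure Ω)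
    (m : ℕ) (a f : ℕ → ℝ) (X U : ℕ → Ω → ℝ) (hM : Model μ m a f X U)
    (ε : ℝ) (hε : 0 < ε)
    (n k : ℕ) (hkn : k ≤ n) (hk : (k : ℝ) ≤ (n : ℝ) * (f 1 - ε)) :
    ∫ ω, max ((k : ℝ) - Zc X (a 1) n ω) 0 ∂μ ≤ 1 / (4 * ε) := by
  have := hM.hprob
  rcases Nat.eq_zero_or_pos n with rfl | hn
  · obtain rfl : k = 0 := by omega
    simp [Zc]
    positivity
  have hn' : (0 : ℝ) < n := by exact_mod_cast hn
  set I : ℕ → Ω → ℝ := fun t ω => if X t ω = a 1 then 1 else 0 with hI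
  have hImeas : ∀ t, Measurable (I t) := fun t =>
    Measurable.ite ((hM.hXmeas t) (measurableSet_singleton _)) measurable_const measurable_const
  have hIb : ∀ t ω, 0 ≤ I t ω ∧ I t ω ≤ 1 := fun t ω => by
    simp only [hI]; split_ifs <;> norm_num
  have hLp : ∀ t, MemLp (I t) 2 μ := fun t =>
    MemLp.of_bound (hImeas t).aestronglyMeasurable 1 (Filter.Eventually.of_forall fun ω => by
      rw [Real.norm_of_nonneg (hIb t ω).1]; exact (hIb t ω).2)
  have hf1 : 0 < f 1 := hM.hf_pos 1 le_rfl hM.hm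
  have hmean : ∀ t, ∫ ω, I t ω ∂μ = f 1 := fun t => by
    have hs : MeasurableSet {ω | X t ω = a 1} := (hM.hXmeas t) (measurableSet_singleton _)
    have : I t = {ω | X t ω = a 1}.indicator (fun _ => (1 : ℝ)) := by
      ext ω; simp [hI, Set.indicator]
    rw [this, integral_indicator hs]
    simp [Measure.real, hM.hXdist t 1 le_rfl hM.hm, hf1.le]
  have hf1' : f 1 ≤ 1 := by
    rw [← hmean 0]
    have := integral_mono (μ := μ) ((hLp 0).integrable (by norm_num)) (integrable_const (1 : ℝ))
      (fun ω => (hIb 0 ω).2)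
    simpa using this
  have hvar : ∀ t, variance (I t) μ ≤ 1 := fun t => by
    refine (variance_le_expectation_sq (hImeas t).aestronglyMeasurable).trans ?_
    have h1 : ∫ ω, (I t ^ 2) ω ∂μ ≤ ∫ ω, (1 : ℝ) ∂μ :=
      integral_mono (hLp t).integrable_sq (integrable_const (1 : ℝ))
        (fun ω => by
          have := hIb t ω
          simp only [Pi.pow_apply]; nlinarith)
    simpa using h1
  have hind : iIndepFun I μ := by
    have hg : Measurable (fun q : ℝ × ℝ => if q.1 = a 1 then (1 : ℝ) else 0) :=
      Measurable.ite (measurable_fst (measurableSet_singleton _)) measurable_const measurable_const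
    exact hM.hIndep.comp (fun _ q => if q.1 = a 1 then (1 : ℝ) else 0) (fun _ => hg)
  have hZ : Zc X (a 1) n = ∑ t ∈ range n, I t := by ext ω; simp [Zc, hI]
  have hZvar : variance (Zc X (a 1) n) μ ≤ n := by
    rw [hZ, IndepFun.variance_sum (fun t _ => hLp t)
      (fun i _ j _ hij => hind.indepFun hij)]
    calc _ ≤ ∑ t ∈ range n, (1 : ℝ) := Finset.sum_le_sum fun t _ => hvar t
      _ = n := by simp
  have hZmean : ∫ ω, Zc X (a 1) n ω ∂μ = n * f 1 := by
    simp only [hZ, Finset.sum_apply]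
    rw [integral_finset_sum _ (fun t _ => (hLp t).integrable (by norm_num))]
    simp [hmean]
  have hZm := Zc_meas X hM.hXmeas (a 1) n
  have hZLp : MemLp (Zc X (a 1) n) 2 μ :=
    MemLp.of_bound hZm.aestronglyMeasurable (n : ℝ) (Filter.Eventually.of_forall fun ω => by
      rw [Real.norm_of_nonneg (Zc_nonneg ..)]; exact Zc_le ..)
  rw [variance_eq_integral hZm.aemeasurable, hZmean] at hZvar
  have hsq : Integrable (fun ω => (Zc X (a 1) n ω - n * f 1) ^ 2) μ :=
    (hZLp.sub (memLp_const (n * f 1))).integrable_sq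
  calc ∫ ω, max ((k : ℝ) - Zc X (a 1) n ω) 0 ∂μ
      ≤ ∫ ω, (1 / (4 * (ε * n))) * (Zc X (a 1) n ω - n * f 1) ^ 2 ∂μ := by
        refine integral_mono_of_nonneg (Filter.Eventually.of_forall fun ω => le_max_right _ _)
          (hsq.const_mul _) (Filter.Eventually.of_forall fun ω => ?_)
        have hc : 0 < ε * n := by positivity
        simp only
        rw [one_div, inv_mul_eq_div, le_div_iff₀ (by positivity)]
        rcases max_cases ((k : ℝ) - Zc X (a 1) n ω) 0 with ⟨h, h'⟩ | ⟨h, h'⟩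
        · rw [h]
          have hh : (k : ℝ) - Zc X (a 1) n ω ≤ (n * f 1 - Zc X (a 1) n ω) - ε * n := by linarith
          have h4 := mul_le_mul_of_nonneg_right hh (by positivity : 0 ≤ 4 * (ε * n))
          nlinarith [sq_nonneg ((n * f 1 - Zc X (a 1) n ω) - 2 * (ε * n))]
        · rw [h, zero_mul]; positivity
    _ = (1 / (4 * (ε * n))) * ∫ ω, (Zc X (a 1) n ω - n * f 1) ^ 2 ∂μ := integral_const_mul _ _
    _ ≤ (1 / (4 * (ε * n))) * n := by gcongr
    _ = 1 / (4 * ε) := by field_simp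

lemma Bna_nonneg {Ω : Type*} (m : ℕ) (a : ℕ → ℝ) (p : ℕ → ℕ → ℝ) (X U : ℕ → Ω → ℝ)
    (t : ℕ) (ω : Ω) : 0 ≤ Bna m a p X U t ω :=
  Finset.sum_nonneg fun t _ => by split_ifs <;> norm_num

lemma Bna_le {Ω : Type*} (m : ℕ) (a : ℕ → ℝ) (p : ℕ → ℕ → ℝ) (X U : ℕ → Ω → ℝ)
    (t : ℕ) (ω : Ω) : Bna m a p X U t ω ≤ m := by
  have : Bna m a p X U t ω ≤ ∑ t ∈ Icc 1 m, (1 : ℝ) :=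
    Finset.sum_le_sum fun t _ => by split_ifs <;> norm_num
  simpa using this

lemma nuNA_le {Ω : Type*} (m : ℕ) (a : ℕ → ℝ) (p : ℕ → ℕ → ℝ) (X U : ℕ → Ω → ℝ)
    (n k : ℕ) (ω : Ω) : nuNA m a p X U n k ω ≤ n + 1 :=
  Nat.sInf_le ⟨by omega, Or.inr (by omega)⟩

lemma term_nonneg {Ω : Type*} (m : ℕ) (a : ℕ → ℝ) (p : ℕ → ℕ → ℝ) (X U : ℕ → Ω → ℝ)
    (r : ℕ) (c : ℝ) (ω : Ω) :
    0 ≤ ∑ t ∈ range r, if X t ω = c then Bna m a p X U t ω else 0 :=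
  Finset.sum_nonneg fun t _ => by
    split_ifs
    · exact Bna_nonneg ..
    · exact le_rfl

lemma VonNA_bdd {Ω : Type*} [MeasurableSpace Ω] (μ : Measure Ω)
    (m : ℕ) (a f : ℕ → ℝ) (X U : ℕ → Ω → ℝ) (hM : Model μ m a f X U) (n k : ℕ) :
    BddAbove {v : ℝ | ∃ p : ℕ → ℕ → ℝ,
      (∀ j t, 0 ≤ p j t ∧ p j t ≤ 1) ∧ v = VonNA μ m a p X U n k} := by
  have := hM.hprob
  refine ⟨∑ j ∈ Icc 1 m, a j * ((n + 1 : ℕ) * m), ?_⟩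
  rintro v ⟨p, -, rfl⟩
  refine Finset.sum_le_sum fun j hj => ?_
  rw [Finset.mem_Icc] at hj
  have ha : 0 ≤ a j := hM.ha_pos.le.trans (aux_a_anti hM.ha_anti hj.1 m hj.2 le_rfl)
  refine mul_le_mul_of_nonneg_left ?_ ha
  have h := norm_integral_le_of_norm_le_const (μ := μ) (C := ((n + 1 : ℕ) * m : ℝ))
    (f := fun ω => ∑ t ∈ range (nuNA m a p X U n k ω),
      if X t ω = a j then Bna m a p X U t ω else 0)
    (Filter.Eventually.of_forall fun ω => by
      rw [Real.norm_of_nonneg (term_nonneg ..)]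
      calc _ ≤ ∑ t ∈ range (nuNA m a p X U n k ω), (m : ℝ) :=
            Finset.sum_le_sum fun t _ => by
              split_ifs
              · exact Bna_le ..
              · positivity
        _ = (nuNA m a p X U n k ω : ℝ) * m := by simp
        _ ≤ _ := by
          have := nuNA_le m a p X U n k ω
          gcongr)
  exact (Real.le_norm_self _).trans (by simpa using h)

lemma policy_value {Ω : Type*} [MeasurableSpace Ω] (μ : Measure Ω)
    (m : ℕ) (a f : ℕ → ℝ) (X U : ℕ → Ω → ℝ) (hM : Model μ m a f X U) (n k : ℕ) (hkn : k ≤ n) :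
    a 1 * ∫ ω, Soff a X k n 1 ω ∂μ
      ≤ VonNA μ m a (fun j _ => if j = 1 then 1 else 0) X U n k := by
  have := hM.hprob
  set p : ℕ → ℕ → ℝ := fun j _ => if j = 1 then 1 else 0 with hp
  have ha : ∀ j ∈ Icc 1 m, 0 ≤ a j := fun j hj => by
    rw [Finset.mem_Icc] at hj
    exact hM.ha_pos.le.trans (aux_a_anti hM.ha_anti hj.1 m hj.2 le_rfl)
  have h1 : 1 ∈ Icc 1 m := by simp [hM.hm]
  have hstep : a 1 * ∫ ω, (∑ t ∈ range (nuNA m a p X U n k ω),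
      if X t ω = a 1 then Bna m a p X U t ω else 0) ∂μ ≤ VonNA μ m a p X U n k :=
    Finset.single_le_sum (f := fun j => a j * ∫ ω, (∑ t ∈ range (nuNA m a p X U n k ω),
      if X t ω = a j then Bna m a p X U t ω else 0) ∂μ)
      (fun j hj => mul_nonneg (ha j hj) (integral_nonneg fun ω => term_nonneg ..)) h1
  refine le_trans (mul_le_mul_of_nonneg_left ?_ (ha 1 h1)) hstep
  rcases Nat.eq_zero_or_pos k with rfl | hk
  · have : ∀ ω, Soff a X 0 n 1 ω = 0 := fun ω => by
      simp [Soff, Zc_nonneg]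
    simp only [this, integral_zero]
    exact integral_nonneg fun ω => term_nonneg ..
  apply le_of_eq
  apply integral_congr_ae
  have hU : ∀ᵐ ω ∂μ, ∀ t, 0 < U t ω ∧ U t ω ≤ 1 := by
    rw [ae_all_iff]
    intro t
    have h : ∀ᵐ x ∂(μ.map (U t)), 0 < x ∧ x ≤ 1 := by
      rw [hM.hUdist t, Measure.restrict_congr_set Ioc_ae_eq_Icc.symm]
      exact ae_restrict_mem measurableSet_Ioc
    exact ae_of_ae_map (hM.hUmeas t).aemeasurable h
  filter_upwards [hU] with ω hω
  have hB : ∀ t, Bna m a p X U t ω = if X t ω = a 1 then 1 else 0 := fun t => by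
    unfold Bna
    rw [Finset.sum_eq_single 1]
    · simp [hp, (hω t).2]
    · intro j _ hj
      have := (hω t).1
      simp [hp, hj, not_le.2 this]
    · intro h; exact absurd h1 h
  have hBs : ∀ r, ∑ t ∈ range r, Bna m a p X U t ω = Zc X (a 1) r ω := fun r => by
    simp only [hB]; rfl
  have hT : ∀ r, (∑ t ∈ range r, if X t ω = a 1 then Bna m a p X U t ω else 0)
      = Zc X (a 1) r ω := fun r => by
    refine Finset.sum_congr rfl fun t _ => ?_
    rw [hB]; split_ifs <;> rfl
  have hS : Soff a X k n 1 ω = min (Zc X (a 1) n ω) k := by simp [Soff]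
  rw [hT, hS]
  have hmem : nuNA m a p X U n k ω ∈ {r : ℕ | 1 ≤ r ∧
      ((k : ℝ) ≤ ∑ t ∈ range r, Bna m a p X U t ω ∨ n ≤ r)} :=
    Nat.sInf_mem ⟨n, by omega, Or.inr le_rfl⟩
  have hle : nuNA m a p X U n k ω ≤ n := Nat.sInf_le ⟨by omega, Or.inr le_rfl⟩
  have hmin : ∀ r, r < nuNA m a p X U n k ω → 1 ≤ r → Zc X (a 1) r ω < k := by
    intro r hr hr1
    by_contra hcon
    rw [not_lt] at hcon
    have : nuNA m a p X U n k ω ≤ r := Nat.sInf_le ⟨hr1, Or.inl (by rw [hBs]; exact hcon)⟩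
    omega
  generalize nuNA m a p X U n k ω = ν at *
  obtain ⟨hν1, hν⟩ := hmem
  rw [hBs] at hν
  obtain ⟨s, rfl⟩ : ∃ s, ν = s + 1 := ⟨ν - 1, by omega⟩
  apply le_antisymm
  · rcases hν with h | h
    · exact (min_le_right _ _).trans h
    · exact (min_le_left _ _).trans (Zc_mono _ _ _ h)
  · refine le_min (Zc_mono _ _ _ hle) ?_
    have hs : Zc X (a 1) s ω < k := by
      rcases Nat.eq_zero_or_pos s with rfl | hs
      · simpa [Zc] using hk
      · exact hmin s (by omega) hs
    obtain ⟨N, hN⟩ := Zc_nat X (a 1) s ω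
    have h3 : Zc X (a 1) (s + 1) ω ≤ Zc X (a 1) s ω + 1 := by
      unfold Zc
      rw [Finset.sum_range_succ]
      gcongr
      split_ifs <;> norm_num
    rw [hN] at h3 hs
    have : N + 1 ≤ k := by exact_mod_cast hs
    have : (N : ℝ) + 1 ≤ k := by exact_mod_cast this
    linarith

lemma Voff_le {Ω : Type*} [MeasurableSpace Ω] (μ : Measure Ω)
    (m : ℕ) (a f : ℕ → ℝ) (X U : ℕ → Ω → ℝ) (hM : Model μ m a f X U) (hm2 : 2 ≤ m) (n k : ℕ) :
    Voff μ m a X n k ≤ a 1 * ∫ ω, Soff a X k n 1 ω ∂μ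
      + a 2 * ∫ ω, max ((k : ℝ) - Zc X (a 1) n ω) 0 ∂μ := by
  have := hM.hprob
  have hSi := Soff_int μ a X hM.hXmeas k n
  have hsplit : ∀ g : ℕ → ℝ, ∑ j ∈ Icc 1 m, g j = g 1 + ∑ j ∈ Icc 2 m, g j := fun g => by
    rw [← Finset.add_sum_Ioc_eq_sum_Icc (by omega : 1 ≤ m)]
    rfl
  have hi : Integrable (fun ω => max ((k : ℝ) - Zc X (a 1) n ω) 0) μ := by
    refine Integrable.of_bound ((measurable_const.sub (Zc_meas X hM.hXmeas _ n)).max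
      measurable_const).aestronglyMeasurable (k : ℝ) (Filter.Eventually.of_forall fun ω => ?_)
    rw [Real.norm_of_nonneg (le_max_right _ _)]
    exact max_le (by linarith [Zc_nonneg X (a 1) n ω]) (by positivity)
  have ha2 : 0 ≤ a 2 := hM.ha_pos.le.trans (aux_a_anti hM.ha_anti (by omega) m hm2 le_rfl)
  unfold Voff
  rw [hsplit]
  gcongr
  calc ∑ j ∈ Icc 2 m, a j * ∫ ω, Soff a X k n j ω ∂μ
      ≤ ∑ j ∈ Icc 2 m, a 2 * ∫ ω, Soff a X k n j ω ∂μ := by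
        refine Finset.sum_le_sum fun j hj => ?_
        rw [Finset.mem_Icc] at hj
        exact mul_le_mul_of_nonneg_right (aux_a_anti hM.ha_anti (by omega) j hj.1 hj.2)
          (integral_nonneg fun ω => Soff_nonneg ..)
    _ = a 2 * ∫ ω, ∑ j ∈ Icc 2 m, Soff a X k n j ω ∂μ := by
        rw [← Finset.mul_sum, integral_finset_sum _ fun j _ => hSi j]
    _ ≤ _ := by
        refine mul_le_mul_of_nonneg_left ?_ ha2
        refine integral_mono (integrable_finset_sum _ fun j _ => hSi j) hi fun ω => ?_
        have h := aux_sort_sum (fun j => Zc X (a j) n ω) (fun j => Zc_nonneg ..) k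
          (by positivity) m
        rw [hsplit] at h
        have h' : ∑ j ∈ Icc 2 m, Soff a X k n j ω = ∑ j ∈ Icc 2 m, min (Zc X (a j) n ω)
          (max ((k : ℝ) - ∑ i ∈ Icc 1 (j - 1), Zc X (a i) n ω) 0) := rfl
        simp only
        rw [h']
        have h4 := min_le_left (k : ℝ) (∑ i ∈ Icc 1 m, Zc X (a i) n ω)
        rw [← h] at h4
        simp at h4
        rcases min_cases (Zc X (a 1) n ω) (k : ℝ) with ⟨h5, h6⟩ | ⟨h5, h6⟩
        · rw [h5] at h4
          exact le_max_of_le_left (by linarith)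
        · rw [h5] at h4
          exact le_max_of_le_right (by linarith)

/-- Lemma 4, non-adaptive regret with a small budget: if
`k ≤ n (f_1 - ε)` then `V_off^*(n,k) - V_na^*(n,k) ≤ a_2/(4ε)`. -/
theorem nonadaptive_small_budget {Ω : Type*} [MeasurableSpace Ω] (μ : Measure Ω)
    (m : ℕ) (a f : ℕ → ℝ) (X U : ℕ → Ω → ℝ) (hM : Model μ m a f X U) (hm2 : 2 ≤ m)
    (ε : ℝ) (hε : ε = minf m f / 2)
    (n k : ℕ) (hkn : k ≤ n) (hk : (k : ℝ) ≤ (n : ℝ) * (f 1 - ε)) :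
    Voff μ m a X n k - VnaStar μ m a X U n k ≤ a 2 / (4 * ε) := by
  have hε0 : 0 < ε := by
    rw [hε]
    exact half_pos (aux_minf_pos hM.hm hM.hf_pos)
  have h1 := Voff_le μ m a f X U hM hm2 n k
  have h2 := policy_value μ m a f X U hM n k hkn
  have h3 := shortfall μ m a f X U hM ε hε0 n k hkn hk
  have ha2 : 0 ≤ a 2 := hM.ha_pos.le.trans (aux_a_anti hM.ha_anti (by omega) m hm2 le_rfl)
  have h4 : VonNA μ m a (fun j _ => if j = 1 then 1 else 0) X U n k ≤ VnaStar μ m a X U n k :=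
    le_csSup (VonNA_bdd μ m a f X U hM n k)
      ⟨_, fun j t => by split_ifs <;> norm_num, rfl⟩
  have h5 := mul_le_mul_of_nonneg_left h3 ha2
  rw [mul_one_div] at h5
  linarith

end MultiSecretary
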